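/- arXiv:1711.09412 — 5 statements merged into one kernel-verified Lean document; each statement's English description precedes it below -/
import Mathlib

section
/- For every pair (a, b) ∈ ℂ² with b² = a·(a − 1)² and (a, b) ≠ (1, 0), there exists u ∈ ℂ with exp(u) ≠ 1 such that ℘(u) = a and deriv ℘ u = b. (That is, (℘, ℘′) parametrises all affine points of the nodal cubic Y² = X(X−1)² other than the singular point (1,0).) -/
/-- `℘(u) = ((1 + e^u)/(1 − e^u))²`. -/
noncomputable def wp : ℂ → ℂ := fun u => ((1 + Complex.exp u) / (1 - Complex.exp u)) ^ 2

theorem statement5 (a b : ℂ) (hab : b ^ 2 = a * (a - 1) ^ 2) (hne : (a, b) ≠ (1, 0)) :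
    ∃ u : ℂ, Complex.exp u ≠ 1 ∧ wp u = a ∧ deriv wp u = b := by
  have ha : a - 1 ≠ 0 := by
    intro h
    apply hne
    have hb : b = 0 := by
      rw [h] at hab
      simpa using hab
    rw [hb, sub_eq_zero.mp h]
  obtain ⟨t, ht⟩ : ∃ t, t = b / (a - 1) := ⟨_, rfl⟩
  have hb : b = t * (a - 1) := by rw [ht]; field_simp
  have hta : t ^ 2 = a := by
    rw [ht, div_pow, hab]; field_simp
  have h1 : t - 1 ≠ 0 := by
    intro h; apply ha; rw [← hta]; linear_combination (t + 1) * h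
  have h2 : t + 1 ≠ 0 := by
    intro h; apply ha; rw [← hta]; linear_combination (t - 1) * h
  have hw : (t - 1) / (t + 1) ≠ 0 := div_ne_zero h1 h2
  have he := Complex.exp_log hw
  set u := Complex.log ((t - 1) / (t + 1)) with hu
  have hm : 1 - Complex.exp u = 2 / (t + 1) := by rw [he]; field_simp; ring
  have hp : 1 + Complex.exp u = 2 * t / (t + 1) := by rw [he]; field_simp; ring
  have hm0 : 1 - Complex.exp u ≠ 0 := by rw [hm]; exact div_ne_zero two_ne_zero h2
  have hq : (1 + Complex.exp u) / (1 - Complex.exp u) = t := by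
    rw [hm, hp]; field_simp
  refine ⟨u, fun h => hm0 (by rw [h, sub_self]), ?_, ?_⟩
  · show ((1 + Complex.exp u) / (1 - Complex.exp u)) ^ 2 = a
    rw [hq, hta]
  · have hd : HasDerivAt wp _ u :=
      ((((Complex.hasDerivAt_exp u).const_add 1).div
        ((Complex.hasDerivAt_exp u).const_sub 1) hm0).pow 2)
    rw [hd.deriv]
    simp only [Pi.div_apply, hq]
    rw [hm, hp, he, hb, ← hta]
    field_simp
    push_cast
    ring
end

section
/- The addition of ℂ transfers through the pair (℘, ℘′) to the chord–tangent law on the nodal cubic Y² = X(X−1)². Precisely: (i) if u₁, u₂ ∈ ℂ satisfy exp(u₁) ≠ 1, exp(u₂) ≠ 1, exp(u₁+u₂) ≠ 1, ℘(u₁) ≠ ℘(u₂) and ℘(u₁)·℘(u₂) ≠ 0, then, setting m = (deriv ℘ u₂ − deriv ℘ u₁)/(℘(u₂) − ℘(u₁)), one has ℘(u₁+u₂) = (deriv ℘ u₁ − ℘(u₁)·m)²/(℘(u₁)·℘(u₂)) and deriv ℘ (u₁+u₂) = −(deriv ℘ u₁) − m·(℘(u₁+u₂) − ℘(u₁)); (ii)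 if u ∈ ℂ satisfies exp(u) ≠ 1, exp(2u) ≠ 1, ℘(u) ≠ 0 and deriv ℘ u ≠ 0, then, setting m = (3·℘(u)² − 4·℘(u) + 1)/(2·deriv ℘ u), one has ℘(2u) = (deriv ℘ u − ℘(u)·m)²/℘(u)² and deriv ℘ (2u) = −(deriv ℘ u) − m·(℘(2u) − ℘(u)). -/
noncomputable def tt (u : ℂ) : ℂ := (1 + Complex.exp u) / (1 - Complex.exp u)

theorem wp_tt (u : ℂ) : wp u = tt u ^ 2 := rfl

theorem deriv_wp_tt (u : ℂ) (h : Complex.exp u ≠ 1) :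
    deriv wp u = tt u * (tt u ^ 2 - 1) := by
  have h' : 1 - Complex.exp u ≠ 0 := sub_ne_zero.mpr h.symm
  have h1 := ((((Complex.hasDerivAt_exp u).const_add 1).div
    ((Complex.hasDerivAt_exp u).const_sub 1) h').pow 2)
  have h2 : HasDerivAt wp _ u := h1
  rw [h2.deriv]
  simp only [tt, Pi.div_apply, Nat.add_one_sub_one, Nat.cast_ofNat, pow_one, show 2 - 1 = 1 from rfl]
  field_simp
  ring

theorem tt_add (u v : ℂ) (hu : Complex.exp u ≠ 1) (hv : Complex.exp v ≠ 1)
    (h : Complex.exp (u + v) ≠ 1) :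
    tt u + tt v ≠ 0 ∧ tt (u + v) = (1 + tt u * tt v) / (tt u + tt v) := by
  have hu' : 1 - Complex.exp u ≠ 0 := sub_ne_zero.mpr hu.symm
  have hv' : 1 - Complex.exp v ≠ 0 := sub_ne_zero.mpr hv.symm
  rw [Complex.exp_add] at h
  have h' : 1 - Complex.exp u * Complex.exp v ≠ 0 := sub_ne_zero.mpr h.symm
  have e : tt u + tt v = 2 * (1 - Complex.exp u * Complex.exp v) /
      ((1 - Complex.exp u) * (1 - Complex.exp v)) := by
    simp only [tt]
    field_simp
    ring
  have e0 : tt u + tt v ≠ 0 := by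
    rw [e]
    exact div_ne_zero (mul_ne_zero two_ne_zero h') (mul_ne_zero hu' hv')
  refine ⟨e0, ?_⟩
  rw [eq_div_iff e0, e]
  simp only [tt, Complex.exp_add]
  field_simp
  ring

theorem statement6 :
    (∀ u₁ u₂ : ℂ, Complex.exp u₁ ≠ 1 → Complex.exp u₂ ≠ 1 → Complex.exp (u₁ + u₂) ≠ 1 →
      wp u₁ ≠ wp u₂ → wp u₁ * wp u₂ ≠ 0 →
      wp (u₁ + u₂) =
        (deriv wp u₁ - wp u₁ * ((deriv wp u₂ - deriv wp u₁) / (wp u₂ - wp u₁))) ^ 2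
          / (wp u₁ * wp u₂) ∧
      deriv wp (u₁ + u₂) =
        -(deriv wp u₁) -
          ((deriv wp u₂ - deriv wp u₁) / (wp u₂ - wp u₁)) * (wp (u₁ + u₂) - wp u₁)) ∧
    (∀ u : ℂ, Complex.exp u ≠ 1 → Complex.exp (2 * u) ≠ 1 → wp u ≠ 0 → deriv wp u ≠ 0 →
      wp (2 * u) =
        (deriv wp u - wp u * ((3 * wp u ^ 2 - 4 * wp u + 1) / (2 * deriv wp u))) ^ 2
          / wp u ^ 2 ∧
      deriv wp (2 * u) =
        -(deriv wp u) -
          ((3 * wp u ^ 2 - 4 * wp u + 1) / (2 * deriv wp u)) * (wp (2 * u) - wp u)) := by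
  constructor
  · intro u v hu hv h hne h0
    obtain ⟨e0, e⟩ := tt_add u v hu hv h
    rw [deriv_wp_tt _ hu, deriv_wp_tt _ hv, deriv_wp_tt _ h]
    simp only [wp_tt] at hne h0 ⊢
    rw [e]
    generalize tt u = t at *
    generalize tt v = s at *
    have ht : t ≠ 0 := by rintro rfl; simp at h0
    have hs : s ≠ 0 := by rintro rfl; simp at h0
    have hd : s ^ 2 - t ^ 2 ≠ 0 := sub_ne_zero.mpr hne.symm
    have hm : (s * (s ^ 2 - 1) - t * (t ^ 2 - 1)) / (s ^ 2 - t ^ 2)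
        = (s ^ 2 + s * t + t ^ 2 - 1) / (t + s) := by
      rw [div_eq_div_iff hd e0]
      ring
    rw [hm]
    constructor
    · field_simp
      ring
    · field_simp
      ring
  · intro u hu h h0 hd
    rw [two_mul] at h ⊢
    obtain ⟨e0, e⟩ := tt_add u u hu hu h
    rw [deriv_wp_tt _ hu] at hd
    rw [deriv_wp_tt _ hu, deriv_wp_tt _ h]
    simp only [wp_tt] at h0 ⊢
    rw [e]
    generalize tt u = t at *
    have ht : t ≠ 0 := by rintro rfl; simp at h0
    have hm : (3 * (t ^ 2) ^ 2 - 4 * t ^ 2 + 1) / (2 * (t * (t ^ 2 - 1)))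
        = (3 * t ^ 2 - 1) / (2 * t) := by
      rw [div_eq_div_iff (mul_ne_zero two_ne_zero hd) (mul_ne_zero two_ne_zero ht)]
      ring
    rw [hm, ← two_mul]
    constructor
    · field_simp
      ring
    · field_simp
      ring
end

section
/- Let r ≥ 1 be a real number and let b be analytic on the closed disk D(0,r). Then there exists a function g analytic on the closed disk D(0,r) such that z·(deriv g z) + g(z)/2 = b(z) for all z in the closed disk {|z| ≤ r}; moreover g is unique on the disk: any two analytic solutions of this equation agree at every point of {|z| ≤ r}. -/
/-- A function `ℂ → ℂ` is analytic on the closed disk `D(0,r)` if it is complex-analytic at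
every point of the closed ball `{|z| ≤ r}` (equivalently, analytic on an open neighborhood). -/
def AnalyticOnDisk (g : ℂ → ℂ) (r : ℝ) : Prop :=
  AnalyticOnNhd ℂ g (Metric.closedBall (0 : ℂ) r)

lemma sq_mul_mem {R : ℝ} {z : ℂ} (hz : ‖z‖ ≤ R) {s : ℝ} (hs : s ∈ Set.Icc (0:ℝ) 1) :
    (s:ℂ)^2 * z ∈ Metric.closedBall (0:ℂ) R := by
  rw [mem_closedBall_zero_iff, norm_mul, norm_pow, Complex.norm_real, Real.norm_eq_abs, sq_abs]
  have h1 : s^2 ≤ 1 := by nlinarith [hs.1, hs.2]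
  nlinarith [norm_nonneg z]

lemma cont_comp {R : ℝ} {z : ℂ} (hz : ‖z‖ ≤ R) {f : ℂ → ℂ}
    (hf : AnalyticOnNhd ℂ f (Metric.closedBall 0 R)) :
    ContinuousOn (fun s : ℝ => f ((s:ℂ)^2 * z)) (Set.Icc 0 1) := by
  refine hf.continuousOn.comp (t := Metric.closedBall 0 R) ?_ (fun s hs => sq_mul_mem hz hs)
  fun_prop

lemma key {R : ℝ} {z : ℂ} (hz : ‖z‖ ≤ R) {f : ℂ → ℂ}
    (hf : AnalyticOnNhd ℂ f (Metric.closedBall 0 R)) :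
    ∫ s in (0:ℝ)..1, (f ((s:ℂ)^2 * z) + 2 * ((s:ℂ)^2 * z * deriv f ((s:ℂ)^2 * z))) = f z := by
  have h := intervalIntegral.integral_eq_sub_of_hasDerivAt (a := 0) (b := 1)
    (f := fun s : ℝ => (s:ℂ) * f ((s:ℂ)^2 * z))
    (f' := fun s : ℝ => f ((s:ℂ)^2 * z) + 2 * ((s:ℂ)^2 * z * deriv f ((s:ℂ)^2 * z))) ?_ ?_
  · simpa using h
  · intro s hs
    rw [Set.uIcc_of_le zero_le_one] at hs
    have hd := (hf _ (sq_mul_mem hz hs)).differentiableAt.hasDerivAt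
    have h1 : HasDerivAt (fun w : ℂ => w ^ 2 * z) (2 * (s:ℂ) * z) (s:ℂ) := by
      simpa using ((hasDerivAt_id (s:ℂ)).pow 2).mul_const z
    have h2 := HasDerivAt.comp (s:ℂ) (h₂ := f) (h := fun w : ℂ => w ^ 2 * z) hd h1
    have h3 := ((hasDerivAt_id (s:ℂ)).mul h2).comp_ofReal
    refine h3.congr_deriv ?_
    simp
    ring
  · refine ContinuousOn.intervalIntegrable ?_
    rw [Set.uIcc_of_le zero_le_one]
    have h1 := cont_comp hz hf
    have h2 := cont_comp hz hf.deriv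
    have h3 : ContinuousOn (fun s : ℝ => (s:ℂ)^2 * z) (Set.Icc 0 1) := by fun_prop
    exact h1.add (continuousOn_const.mul (h3.mul h2))

lemma deriv_int {R : ℝ} {f : ℂ → ℂ}
    (hf : AnalyticOnNhd ℂ f (Metric.closedBall 0 R)) {z : ℂ} (hz : ‖z‖ < R) :
    HasDerivAt (fun w : ℂ => ∫ s in (0:ℝ)..1, 2 * f ((s:ℂ)^2 * w))
      (∫ s in (0:ℝ)..1, 2 * ((s:ℂ)^2 * deriv f ((s:ℂ)^2 * z))) z := by
  obtain ⟨C, hC⟩ := (isCompact_closedBall (0:ℂ) R).exists_bound_of_continuousOn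
    hf.deriv.continuousOn
  have hsub : Set.uIoc (0:ℝ) 1 ⊆ Set.Icc 0 1 := by
    rw [Set.uIoc_of_le zero_le_one]; exact Set.Ioc_subset_Icc_self
  have hint : ∀ w : ℂ, ‖w‖ ≤ R → IntervalIntegrable (fun s : ℝ => 2 * f ((s:ℂ)^2 * w))
      MeasureTheory.volume 0 1 := by
    intro w hw
    refine ContinuousOn.intervalIntegrable ?_
    rw [Set.uIcc_of_le zero_le_one]
    exact continuousOn_const.mul (cont_comp hw hf)
  have hint' : IntervalIntegrable (fun s : ℝ => 2 * ((s:ℂ)^2 * deriv f ((s:ℂ)^2 * z)))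
      MeasureTheory.volume 0 1 := by
    refine ContinuousOn.intervalIntegrable ?_
    rw [Set.uIcc_of_le zero_le_one]
    have h3 : ContinuousOn (fun s : ℝ => (s:ℂ)^2) (Set.Icc 0 1) := by fun_prop
    exact continuousOn_const.mul (h3.mul (cont_comp hz.le hf.deriv))
  have hball : Metric.ball (0:ℂ) R ∈ nhds z :=
    Metric.isOpen_ball.mem_nhds (mem_ball_zero_iff.2 hz)
  refine (intervalIntegral.hasDerivAt_integral_of_dominated_loc_of_deriv_le
    (F := fun w (s:ℝ) => 2 * f ((s:ℂ)^2 * w))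
    (F' := fun w (s:ℝ) => 2 * ((s:ℂ)^2 * deriv f ((s:ℂ)^2 * w)))
    (bound := fun _ => 2 * C) hball ?_ (hint z hz.le) (intervalIntegrable_iff.1 hint').aestronglyMeasurable ?_
    (by simp) ?_).2
  · filter_upwards [hball] with w hw
    exact (intervalIntegrable_iff.1 (hint w (mem_ball_zero_iff.1 hw).le)).aestronglyMeasurable
  · refine Filter.Eventually.of_forall fun s hs w hw => ?_
    have hs' := hsub hs
    have := hC _ (sq_mul_mem (mem_ball_zero_iff.1 hw).le hs')
    rw [norm_mul, norm_mul, norm_pow, Complex.norm_real, Real.norm_eq_abs, sq_abs]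
    have h1 : s^2 ≤ 1 := by nlinarith [hs'.1, hs'.2]
    simp only [Complex.norm_ofNat]
    nlinarith [norm_nonneg (deriv f ((s:ℂ)^2 * w))]
  · refine Filter.Eventually.of_forall fun s hs w hw => ?_
    have hd := (hf _ (sq_mul_mem (mem_ball_zero_iff.1 hw).le
      (hsub hs))).differentiableAt.hasDerivAt
    have h1 : HasDerivAt (fun w : ℂ => (s:ℂ) ^ 2 * w) ((s:ℂ)^2) w := by
      simpa using (hasDerivAt_id w).const_mul ((s:ℂ)^2)
    have h2 := HasDerivAt.comp w (h₂ := f) (h := fun w : ℂ => (s:ℂ) ^ 2 * w) hd h1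
    refine (h2.const_mul 2).congr_deriv ?_
    ring

lemma uniq_formula {r : ℝ} {b g : ℂ → ℂ}
    (hg : AnalyticOnNhd ℂ g (Metric.closedBall 0 r))
    (h : ∀ z ∈ Metric.closedBall (0 : ℂ) r, z * deriv g z + g z / 2 = b z)
    {z : ℂ} (hz : ‖z‖ ≤ r) : g z = ∫ s in (0:ℝ)..1, 2 * b ((s:ℂ)^2 * z) := by
  rw [← key hz hg]
  refine intervalIntegral.integral_congr fun s hs => ?_
  rw [Set.uIcc_of_le zero_le_one] at hs
  rw [← h _ (sq_mul_mem hz hs)]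
  ring

theorem statement7 (r : ℝ) (hr : 1 ≤ r) (b : ℂ → ℂ) (hb : AnalyticOnDisk b r) :
    (∃ g : ℂ → ℂ, AnalyticOnDisk g r ∧
      ∀ z ∈ Metric.closedBall (0 : ℂ) r, z * deriv g z + g z / 2 = b z) ∧
    (∀ g₁ g₂ : ℂ → ℂ, AnalyticOnDisk g₁ r → AnalyticOnDisk g₂ r →
      (∀ z ∈ Metric.closedBall (0 : ℂ) r, z * deriv g₁ z + g₁ z / 2 = b z) →
      (∀ z ∈ Metric.closedBall (0 : ℂ) r, z * deriv g₂ z + g₂ z / 2 = b z) →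
      ∀ z ∈ Metric.closedBall (0 : ℂ) r, g₁ z = g₂ z) := by
  constructor
  · obtain ⟨δ, hδ, hsub⟩ := (isCompact_closedBall (0:ℂ) r).exists_cthickening_subset_open
      (isOpen_analyticAt ℂ b) (fun z hz => hb z hz)
    rw [cthickening_closedBall hδ.le (by linarith)] at hsub
    have hf : AnalyticOnNhd ℂ b (Metric.closedBall 0 (δ + r)) := fun z hz => hsub hz
    refine ⟨fun w : ℂ => ∫ s in (0:ℝ)..1, 2 * b ((s:ℂ)^2 * w), ?_, ?_⟩
    · have hd : DifferentiableOn ℂ (fun w : ℂ => ∫ s in (0:ℝ)..1, 2 * b ((s:ℂ)^2 * w))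
          (Metric.ball 0 (δ + r)) := fun w hw =>
        (deriv_int hf (mem_ball_zero_iff.1 hw)).differentiableAt.differentiableWithinAt
      exact (hd.analyticOnNhd Metric.isOpen_ball).mono
        (Metric.closedBall_subset_ball (by linarith))
    · intro z hz
      rw [mem_closedBall_zero_iff] at hz
      have hz' : ‖z‖ < δ + r := by linarith
      rw [(deriv_int hf hz').deriv]
      conv_rhs => rw [← key hz hb]
      rw [intervalIntegral.integral_add]
      · beta_reduce
        rw [← intervalIntegral.integral_const_mul z,
          intervalIntegral.integral_const_mul 2 (fun s : ℝ => b ((s:ℂ)^2 * z)), mul_div_cancel_left₀ _ two_ne_zero, add_comm]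
        congr 1
        refine intervalIntegral.integral_congr fun s hs => ?_
        ring
      · refine ContinuousOn.intervalIntegrable ?_
        rw [Set.uIcc_of_le zero_le_one]
        exact cont_comp hz hb
      · refine ContinuousOn.intervalIntegrable ?_
        rw [Set.uIcc_of_le zero_le_one]
        have h3 : ContinuousOn (fun s : ℝ => (s:ℂ)^2 * z) (Set.Icc 0 1) := by fun_prop
        exact continuousOn_const.mul (h3.mul (cont_comp hz hb.deriv))
  · intro g₁ g₂ h₁ h₂ e₁ e₂ z hz
    rw [mem_closedBall_zero_iff] at hz
    rw [uniq_formula h₁ e₁ hz, uniq_formula h₂ e₂ hz]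
end

section
/- Let r ≥ 1 be a real number and let b be analytic on the closed disk D(0,r). Then there exist a function g analytic on the closed disk D(0,r) and a constant γ ∈ ℂ such that z·(z−1)·(deriv g z) + ((3z−1)/2)·g(z) = b(z) − γ for all z in the closed disk {|z| ≤ r}; moreover the pair is unique: γ is uniquely determined and any two analytic solutions g agree at every point of {|z| ≤ r}. -/
lemma ode_h (R : ℝ) (hR : 0 < R) (b : ℂ → ℂ)
    (hb : AnalyticOnNhd ℂ b (Metric.closedBall (0 : ℂ) R)) :
    ∃ H : ℂ → ℂ, DifferentiableOn ℂ H (Metric.ball (0 : ℂ) R) ∧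
      ∀ z ∈ Metric.ball (0 : ℂ) R, z * deriv H z + H z / 2 = b z := by
  have hmem : ∀ z ∈ Metric.ball (0 : ℂ) R, ∀ s ∈ Set.Icc (0 : ℝ) 1,
      z * (s : ℂ) ^ 2 ∈ Metric.closedBall (0 : ℂ) R := by
    intro z hz s hs
    simp only [mem_ball_zero_iff, mem_closedBall_zero_iff, norm_mul, norm_pow,
      Complex.norm_real, Real.norm_eq_abs, sq_abs, Set.mem_Icc] at *
    have h1 : s ^ 2 ≤ 1 := by nlinarith
    nlinarith [norm_nonneg z, sq_nonneg s]
  have hcont : ∀ f : ℂ → ℂ, ContinuousOn f (Metric.closedBall (0 : ℂ) R) →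
      ∀ z ∈ Metric.ball (0 : ℂ) R,
      ContinuousOn (fun s : ℝ => f (z * (s : ℂ) ^ 2)) (Set.Icc (0 : ℝ) 1) := by
    intro f hf z hz
    refine hf.comp (t := Metric.closedBall (0 : ℂ) R) ?_ (fun s hs => hmem z hz s hs)
    exact (by fun_prop : Continuous fun s : ℝ => z * (s : ℂ) ^ 2).continuousOn
  have hbc : ContinuousOn b (Metric.closedBall (0 : ℂ) R) := hb.continuousOn
  have hdc : ContinuousOn (deriv b) (Metric.closedBall (0 : ℂ) R) := hb.deriv.continuousOn
  obtain ⟨C, hC⟩ := (isCompact_closedBall (0 : ℂ) R).exists_bound_of_continuousOn hdc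
  have hu : Set.uIcc (0 : ℝ) 1 = Set.Icc 0 1 := Set.uIcc_of_le zero_le_one
  have huo : Set.uIoc (0 : ℝ) 1 = Set.Ioc 0 1 := Set.uIoc_of_le zero_le_one
  have hbi : ∀ z ∈ Metric.ball (0 : ℂ) R, IntervalIntegrable
      (fun s : ℝ => b (z * (s : ℂ) ^ 2)) MeasureTheory.volume 0 1 := fun z hz =>
    ContinuousOn.intervalIntegrable (by rw [hu]; exact hcont b hbc z hz)
  have hdco : ∀ z ∈ Metric.ball (0 : ℂ) R, ContinuousOn
      (fun s : ℝ => (s : ℂ) ^ 2 * deriv b (z * (s : ℂ) ^ 2)) (Set.Icc (0 : ℝ) 1) := fun z hz =>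
    ((by fun_prop : Continuous fun s : ℝ => (s : ℂ) ^ 2).continuousOn).mul (hcont _ hdc z hz)
  have hdi : ∀ z ∈ Metric.ball (0 : ℂ) R, IntervalIntegrable
      (fun s : ℝ => (s : ℂ) ^ 2 * deriv b (z * (s : ℂ) ^ 2)) MeasureTheory.volume 0 1 :=
    fun z hz => ContinuousOn.intervalIntegrable (by rw [hu]; exact hdco z hz)
  have key : ∀ z ∈ Metric.ball (0 : ℂ) R,
      HasDerivAt (fun z : ℂ => ∫ s in (0 : ℝ)..1, b (z * (s : ℂ) ^ 2))
        (∫ s in (0 : ℝ)..1, (s : ℂ) ^ 2 * deriv b (z * (s : ℂ) ^ 2)) z := by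
    intro z hz
    have hn : Metric.ball (0 : ℂ) R ∈ nhds z := Metric.isOpen_ball.mem_nhds hz
    refine (intervalIntegral.hasDerivAt_integral_of_dominated_loc_of_deriv_le
      (F := fun (z : ℂ) (s : ℝ) => b (z * (s : ℂ) ^ 2))
      (F' := fun (z : ℂ) (s : ℝ) => (s : ℂ) ^ 2 * deriv b (z * (s : ℂ) ^ 2))
      (bound := fun _ => C) hn ?_ (hbi z hz) ?_ ?_ ?_ ?_).2
    · filter_upwards [hn] with w hw
      exact (hbi w hw).aestronglyMeasurable_restrict_uIoc
    · exact (hdi z hz).aestronglyMeasurable_restrict_uIoc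
    · refine Filter.Eventually.of_forall fun s hs w hw => ?_
      rw [huo] at hs
      have hs' : s ∈ Set.Icc (0 : ℝ) 1 := Set.Ioc_subset_Icc_self hs
      have h2 := hC _ (hmem w hw s hs')
      simp only [norm_mul, norm_pow, Complex.norm_real, Real.norm_eq_abs, sq_abs]
      have h1 : s ^ 2 ≤ 1 := by nlinarith [hs.1, hs.2]
      nlinarith [norm_nonneg (deriv b (w * (s : ℂ) ^ 2)), sq_nonneg s]
    · exact intervalIntegrable_const
    · refine Filter.Eventually.of_forall fun s hs w hw => ?_
      rw [huo] at hs
      have hs' : s ∈ Set.Icc (0 : ℝ) 1 := Set.Ioc_subset_Icc_self hs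
      have h1 := (hb _ (hmem w hw s hs')).differentiableAt.hasDerivAt
      have h2 : HasDerivAt (fun w : ℂ => w * (s : ℂ) ^ 2) ((s : ℂ) ^ 2) w := by
        simpa using (hasDerivAt_id w).mul_const ((s : ℂ) ^ 2)
      have := h1.comp w h2
      rw [mul_comm] at this
      exact this
  refine ⟨fun z => 2 * ∫ s in (0 : ℝ)..1, b (z * (s : ℂ) ^ 2), fun z hz =>
    ((key z hz).const_mul 2).differentiableAt.differentiableWithinAt, fun z hz => ?_⟩
  rw [((key z hz).const_mul 2).deriv]
  have hder : ∀ s ∈ Set.uIcc (0 : ℝ) 1, HasDerivAt (fun s : ℝ => (s : ℂ) * b (z * (s : ℂ) ^ 2))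
      (b (z * (s : ℂ) ^ 2) + 2 * z * ((s : ℂ) ^ 2 * deriv b (z * (s : ℂ) ^ 2))) s := by
    intro s hs
    rw [hu] at hs
    have h1 := (hb _ (hmem z hz s hs)).differentiableAt.hasDerivAt
    have h2 : HasDerivAt (fun w : ℂ => z * w ^ 2) (z * (2 * (s : ℂ))) (s : ℂ) := by
      simpa using (hasDerivAt_pow 2 (s : ℂ)).const_mul z
    have h3 := ((hasDerivAt_id (s : ℂ)).mul (h1.comp (s : ℂ) h2)).comp_ofReal
    refine h3.congr_deriv ?_
    simp only [id, Function.comp]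
    ring
  have hi := intervalIntegral.integral_eq_sub_of_hasDerivAt hder
    ((hbi z hz).add ((hdi z hz).const_mul (2 * z)))
  rw [intervalIntegral.integral_add (hbi z hz) ((hdi z hz).const_mul (2 * z)),
    intervalIntegral.integral_const_mul] at hi
  simp at hi
  rw [← hi]
  ring

lemma ode_unique (r : ℝ) (hr : 1 ≤ r) (g : ℂ → ℂ) (c : ℂ)
    (hg : AnalyticOnNhd ℂ g (Metric.closedBall (0 : ℂ) r))
    (h : ∀ z ∈ Metric.closedBall (0 : ℂ) r,
        z * (z - 1) * deriv g z + (3 * z - 1) / 2 * g z = c) :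
    c = 0 ∧ ∀ z ∈ Metric.closedBall (0 : ℂ) r, g z = 0 := by
  have h0 : (0 : ℂ) ∈ Metric.closedBall (0 : ℂ) r := by simp; linarith
  have h1 : (1 : ℂ) ∈ Metric.closedBall (0 : ℂ) r := by simpa using hr
  have hd : ∀ z ∈ Metric.closedBall (0 : ℂ) r, HasDerivWithinAt
      (fun z => z * ((z - 1) * g z - 2 * c) ^ 2) 0 (Metric.closedBall (0 : ℂ) r) z := by
    intro z hz
    have e1 := (hg z hz).differentiableAt.hasDerivAt
    have e2 := (hasDerivAt_id z).mul
      (((((hasDerivAt_id z).sub_const 1).mul e1).sub_const (2 * c)).pow 2)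
    refine HasDerivAt.hasDerivWithinAt (e2.congr_deriv ?_)
    have := h z hz
    simp
    linear_combination 2 * ((z - 1) * g z - 2 * c) * this
  have hz : ∀ z ∈ Metric.closedBall (0 : ℂ) r, z ≠ 0 → (z - 1) * g z = 2 * c := by
    intro z hz hz0
    have := (convex_closedBall (0 : ℂ) r).norm_image_sub_le_of_norm_hasDerivWithin_le
      (C := 0) hd (by simp) h0 hz
    rw [zero_mul, sub_zero, zero_mul, norm_le_zero_iff] at this
    have h5 := pow_eq_zero_iff (two_ne_zero) |>.1 ((mul_eq_zero.1 this).resolve_left hz0)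
    linear_combination h5
  have hc : c = 0 := by
    have := hz 1 h1 one_ne_zero
    simpa using this.symm
  refine ⟨hc, fun z hzz => ?_⟩
  subst hc
  by_cases hz0 : z = 0
  · subst hz0
    simpa using h 0 h0
  by_cases hz1 : z = 1
  · subst hz1
    have := h 1 h1
    norm_num at this
    exact this
  · have := hz z hzz hz0
    simpa [sub_ne_zero.2 hz1] using this


theorem statement8 (r : ℝ) (hr : 1 ≤ r) (b : ℂ → ℂ) (hb : AnalyticOnDisk b r) :
    (∃ (g : ℂ → ℂ) (γ : ℂ), AnalyticOnDisk g r ∧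
      ∀ z ∈ Metric.closedBall (0 : ℂ) r,
        z * (z - 1) * deriv g z + (3 * z - 1) / 2 * g z = b z - γ) ∧
    (∀ (g₁ g₂ : ℂ → ℂ) (γ₁ γ₂ : ℂ), AnalyticOnDisk g₁ r → AnalyticOnDisk g₂ r →
      (∀ z ∈ Metric.closedBall (0 : ℂ) r,
        z * (z - 1) * deriv g₁ z + (3 * z - 1) / 2 * g₁ z = b z - γ₁) →
      (∀ z ∈ Metric.closedBall (0 : ℂ) r,
        z * (z - 1) * deriv g₂ z + (3 * z - 1) / 2 * g₂ z = b z - γ₂) →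
      γ₁ = γ₂ ∧ ∀ z ∈ Metric.closedBall (0 : ℂ) r, g₁ z = g₂ z) := by
  constructor
  · obtain ⟨δ, hδ, hsub⟩ := (isCompact_closedBall (0 : ℂ) r).exists_cthickening_subset_open
      (isOpen_analyticAt ℂ b) hb
    rw [cthickening_closedBall hδ.le (by linarith)] at hsub
    obtain ⟨H, hH, hHe⟩ := ode_h (δ + r) (by linarith) b hsub
    have hn : ∀ z ∈ Metric.closedBall (0 : ℂ) r, Metric.ball (0 : ℂ) (δ + r) ∈ nhds z := by
      intro z hz
      refine Metric.isOpen_ball.mem_nhds ?_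
      simp at *
      linarith
    have h1 : (1 : ℂ) ∈ Metric.closedBall (0 : ℂ) r := by simpa using hr
    have hg : DifferentiableOn ℂ (dslope H 1) (Metric.ball (0 : ℂ) (δ + r)) :=
      (Complex.differentiableOn_dslope (hn 1 h1)).2 hH
    refine ⟨dslope H 1, H 1 / 2, fun z hz => hg.analyticAt (hn z hz), fun z hz => ?_⟩
    have e1 := (hg.differentiableAt (hn z hz)).hasDerivAt
    have e2 := ((((hasDerivAt_id z).sub_const 1).mul e1).add_const (H 1))
    have e3 : ∀ w : ℂ, H w = (w - 1) * dslope H 1 w + H 1 := by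
      intro w
      have := sub_smul_dslope H 1 w
      rw [smul_eq_mul] at this
      rw [this]; ring
    have e4 : HasDerivAt H (dslope H 1 z + (z - 1) * deriv (dslope H 1) z) z := by
      refine (e2.congr_deriv ?_).congr_of_eventuallyEq (Filter.Eventually.of_forall e3)
      simp
    have e5 := hHe z (mem_of_mem_nhds (hn z hz))
    rw [e4.deriv] at e5
    linear_combination e5 - e3 z / 2
  · intro g₁ g₂ γ₁ γ₂ hg₁ hg₂ h₁ h₂
    have := ode_unique r hr (g₁ - g₂) (γ₂ - γ₁) (hg₁.sub hg₂) (fun z hz => by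
      rw [deriv_sub (hg₁ z hz).differentiableAt (hg₂ z hz).differentiableAt, Pi.sub_apply]
      linear_combination h₁ z hz - h₂ z hz)
    exact ⟨(sub_eq_zero.1 this.1).symm, fun z hz => sub_eq_zero.1 (this.2 z hz)⟩
end

section
/- (Integrality at the singular point, one-variable form) Let x, y : ℂ → ℂ be meromorphic on ℂ, with y not vanishing identically on any nonempty open subset of ℂ. Assume that off a discrete set, z·(z−1)²·y(z)² = x(z)·(x(z)−1)². Let A : ℂ → ℂ be entire and assume that off a discrete set, A(z)·y(z) = deriv x z. Then A(1) is a rational integer: there exists n ∈ ℤ with A(1) = n. -/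
/-- A property of complex numbers holds "off a discrete set" if there is a subset `S ⊆ ℂ`,
closed and discrete in `ℂ`, such that the property holds at every point of `ℂ ∖ S`. -/
def OffDiscrete (P : ℂ → Prop) : Prop :=
  ∃ S : Set ℂ, IsClosed S ∧ DiscreteTopology S ∧ ∀ z ∉ S, P z

/-- A property that holds off a closed discrete set holds on a punctured neighbourhood. -/
theorem OffDiscrete.ev {P : ℂ → Prop} (h : OffDiscrete P) (a : ℂ) :
    ∀ᶠ z in nhdsWithin a {a}ᶜ, P z := by
  obtain ⟨S, hc, hd, hS⟩ := h
  have h1 : Disjoint (nhdsWithin a {a}ᶜ) (Filter.principal S) :=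
    (isClosed_and_discrete_iff.1 ⟨hc, isDiscrete_iff_discreteTopology.2 hd⟩) a
  rw [Filter.disjoint_principal_right] at h1
  filter_upwards [h1] with z hz using hS z hz

theorem local_form {x : ℂ → ℂ} {a : ℂ} (hx : MeromorphicAt x a) (c : ℂ) :
    (∀ᶠ z in nhdsWithin a {a}ᶜ, deriv x z = 0) ∨
    ∃ (k : ℤ) (g : ℂ → ℂ), AnalyticAt ℂ g a ∧ g a ≠ 0 ∧ ∀ᶠ z in nhdsWithin a {a}ᶜ,
      x z = c + (z - a) ^ k * g z ∧
      (z - a) * deriv x z = (z - a) ^ k * (k * g z + (z - a) * deriv g z) := by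
  have hm : MeromorphicAt (fun z => x z - c) a := hx.sub (MeromorphicAt.const c a)
  by_cases ht : meromorphicOrderAt (fun z => x z - c) a = ⊤
  · left
    rw [meromorphicOrderAt_eq_top_iff] at ht
    have h2 := eventually_eventually_nhdsWithin.2 ht
    filter_upwards [h2, self_mem_nhdsWithin] with z hz hza
    rw [IsOpen.nhdsWithin_eq isOpen_compl_singleton hza] at hz
    have : x =ᶠ[nhds z] fun _ => c := hz.mono fun w hw => sub_eq_zero.1 hw
    rw [this.deriv_eq]; simp
  · right
    obtain ⟨k, hk⟩ := WithTop.ne_top_iff_exists.1 ht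
    obtain ⟨g, hg, hg0, hev⟩ := (meromorphicOrderAt_eq_int_iff hm).1 hk.symm
    refine ⟨k, g, hg, hg0, ?_⟩
    have h2 := eventually_eventually_nhdsWithin.2 hev
    have h3 := hg.eventually_analyticAt.filter_mono (nhdsWithin_le_nhds (s := {a}ᶜ))
    filter_upwards [hev, h2, h3, self_mem_nhdsWithin] with z hz1 hz hgz hza
    have hw : z - a ≠ 0 := sub_ne_zero.2 hza
    rw [smul_eq_mul] at hz1
    refine ⟨by rw [← hz1]; ring, ?_⟩
    rw [IsOpen.nhdsWithin_eq isOpen_compl_singleton hza] at hz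
    have he : x =ᶠ[nhds z] fun w => c + (w - a) ^ k * g w := hz.mono fun w hw => by
      rw [smul_eq_mul] at hw
      show x w = c + (w - a) ^ k * g w
      rw [← hw]; ring
    have hd : HasDerivAt (fun w => c + (w - a) ^ k * g w)
        ((k * (z - a) ^ (k - 1) * 1) * g z + (z - a) ^ k * deriv g z) z := by
      have h4 : HasDerivAt (fun w : ℂ => (w - a) ^ k) (k * (z - a) ^ (k - 1) * 1) z :=
        HasDerivAt.comp (h₂ := fun u : ℂ => u ^ k) (h := fun w : ℂ => w - a) z
          (hasDerivAt_zpow k (z - a) (Or.inl hw)) ((hasDerivAt_id z).sub_const a)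
      exact (h4.mul hgz.differentiableAt.hasDerivAt).const_add c
    rw [he.deriv_eq, hd.deriv, zpow_sub_one₀ hw]
    field_simp

theorem eq_at {F G : ℂ → ℂ} {a : ℂ} (hF : ContinuousAt F a) (hG : ContinuousAt G a)
    (h : ∀ᶠ z in nhdsWithin a {a}ᶜ, F z = G z) : F a = G a :=
  tendsto_nhds_unique_of_eventuallyEq (hF.tendsto.mono_left nhdsWithin_le_nhds)
    (hG.tendsto.mono_left nhdsWithin_le_nhds) h

theorem statement12 (x y : ℂ → ℂ)
    (hx : MeromorphicOn x Set.univ) (hy : MeromorphicOn y Set.univ)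
    (hynz : ∀ U : Set ℂ, IsOpen U → U.Nonempty → ∃ z ∈ U, y z ≠ 0)
    (hMD : OffDiscrete fun z => z * (z - 1) ^ 2 * y z ^ 2 = x z * (x z - 1) ^ 2)
    (A : ℂ → ℂ) (hA : Differentiable ℂ A)
    (hAy : OffDiscrete fun z => A z * y z = deriv x z) :
    ∃ n : ℤ, A 1 = (n : ℂ) := by
  have hAc : ContinuousAt A 1 := hA.continuous.continuousAt
  have hx1 := hx 1 (Set.mem_univ _)
  have hy1 := hy 1 (Set.mem_univ _)
  -- the constant case
  have hconst : (∀ᶠ z in nhdsWithin (1 : ℂ) {1}ᶜ, deriv x z = 0) → A 1 = 0 := by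
    intro h
    have hyne : ∀ᶠ z in nhdsWithin (1 : ℂ) {1}ᶜ, y z ≠ 0 := by
      rcases hy1.eventually_eq_zero_or_eventually_ne_zero with h0 | h0
      · exfalso
        have h2 := eventually_eventually_nhdsWithin.2 h0
        obtain ⟨p, hp, hp1⟩ := (h2.and self_mem_nhdsWithin).exists
        rw [IsOpen.nhdsWithin_eq isOpen_compl_singleton hp1] at hp
        obtain ⟨U, hU, hUo, hpU⟩ := eventually_nhds_iff.1 hp
        obtain ⟨z, hz, hz0⟩ := hynz U hUo ⟨p, hpU⟩
        exact hz0 (hU z hz)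
      · exact h0
    refine eq_at (G := fun _ => 0) hAc continuousAt_const ?_
    filter_upwards [h, hyne, hAy.ev 1] with z h1 h2 h3
    rw [h1] at h3
    exact (mul_eq_zero.1 h3).resolve_right h2
  have hmain : ∀ᶠ z in nhdsWithin (1 : ℂ) {1}ᶜ,
      z * ((z - 1) * deriv x z) ^ 2 = A z ^ 2 * (x z * (x z - 1) ^ 2) := by
    filter_upwards [hMD.ev 1, hAy.ev 1] with z h1 h2
    rw [← h1, ← h2]; ring
  rcases local_form hx1 1 with h | ⟨k, g, hg, hg0, hev⟩
  · exact ⟨0, by simpa using hconst h⟩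
  have hgc := hg.continuousAt
  have hgd := hg.deriv.continuousAt
  have hkey : ∀ᶠ z in nhdsWithin (1 : ℂ) {1}ᶜ,
      z * (k * g z + (z - 1) * deriv g z) ^ 2 = A z ^ 2 * ((1 + (z - 1) ^ k * g z) * g z ^ 2) := by
    filter_upwards [hmain, hev, self_mem_nhdsWithin] with z h1 h2 h3
    have hw : (z - 1) ^ k ≠ 0 := zpow_ne_zero _ (sub_ne_zero.2 h3)
    rw [h2.2, h2.1] at h1
    apply mul_left_cancel₀ (pow_ne_zero 2 hw)
    linear_combination h1
  rcases lt_trichotomy k 0 with hk | hk | hk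
  · -- pole
    obtain ⟨m, rfl⟩ : ∃ m : ℕ, k = -((m + 1 : ℕ) : ℤ) := ⟨(-k - 1).toNat, by omega⟩
    have := eq_at (a := 1)
      (F := fun z => (z - 1) ^ (m + 1) * (z * (((-((m + 1 : ℕ) : ℤ) : ℤ) : ℂ) * g z
        + (z - 1) * deriv g z) ^ 2))
      (G := fun z => A z ^ 2 * (((z - 1) ^ (m + 1) + g z) * g z ^ 2))
      (by fun_prop) (by fun_prop) (by
        filter_upwards [hkey, self_mem_nhdsWithin] with z h1 h3
        have hw : (z - 1) ^ (m + 1) ≠ 0 := pow_ne_zero _ (sub_ne_zero.2 h3)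
        rw [h1, zpow_neg, zpow_natCast]
        field_simp)
    simp [hg0] at this
    exact ⟨0, by simpa using this⟩
  · subst hk
    have h0 := eq_at (a := 1)
      (F := fun z => z * (((0 : ℤ) : ℂ) * g z + (z - 1) * deriv g z) ^ 2)
      (G := fun z => A z ^ 2 * ((1 + g z) * g z ^ 2))
      (by fun_prop) (by fun_prop) (by
        filter_upwards [hkey] with z h1
        rw [h1]; simp)
    simp [hg0] at h0
    rcases h0 with h0 | h0
    · exact ⟨0, by simpa using h0⟩
    -- x tends to 0 at 1
    rcases local_form hx1 0 with h | ⟨l, f, hf, hf0, hev2⟩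
    · exact ⟨0, by simpa using hconst h⟩
    have hfc := hf.continuousAt
    have hfd := hf.deriv.continuousAt
    have hl : 0 < l := by
      by_contra hl
      obtain ⟨m, rfl⟩ : ∃ m : ℕ, l = -(m : ℤ) := ⟨(-l).toNat, by omega⟩
      have := eq_at (a := 1) (F := fun z => (z - 1) ^ m * (1 + g z)) (G := f)
        (by fun_prop) (by fun_prop) (by
          filter_upwards [hev, hev2, self_mem_nhdsWithin] with z h1 h2 h3
          have hw : (z - 1) ^ m ≠ 0 := pow_ne_zero _ (sub_ne_zero.2 h3)
          have h4 := h1.1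
          rw [h2.1, zpow_neg, zpow_natCast] at h4
          simp at h4
          rw [← h4]
          field_simp)
      simp [h0] at this
      exact hf0 this.symm
    obtain ⟨m, rfl⟩ : ∃ m : ℕ, l = ((m + 1 : ℕ) : ℤ) := ⟨(l - 1).toNat, by omega⟩
    have := eq_at (a := 1)
      (F := fun z => (z - 1) ^ (m + 1) * (z * ((((m + 1 : ℕ) : ℤ) : ℂ) * f z
        + (z - 1) * deriv f z) ^ 2))
      (G := fun z => A z ^ 2 * (f z * ((z - 1) ^ (m + 1) * f z - 1) ^ 2))
      (by fun_prop) (by fun_prop) (by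
        filter_upwards [hmain, hev2, self_mem_nhdsWithin] with z h1 h2 h3
        have hw : (z - 1) ^ (m + 1) ≠ 0 := pow_ne_zero _ (sub_ne_zero.2 h3)
        rw [h2.2, h2.1, zpow_natCast] at h1
        apply mul_left_cancel₀ hw
        linear_combination h1)
    simp [hf0] at this
    exact ⟨0, by simpa using this⟩
  · obtain ⟨m, rfl⟩ : ∃ m : ℕ, k = ((m + 1 : ℕ) : ℤ) := ⟨(k - 1).toNat, by omega⟩
    have := eq_at (a := 1)
      (F := fun z => z * ((((m + 1 : ℕ) : ℤ) : ℂ) * g z + (z - 1) * deriv g z) ^ 2)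
      (G := fun z => A z ^ 2 * ((1 + (z - 1) ^ (m + 1) * g z) * g z ^ 2))
      (by fun_prop) (by fun_prop) (by
        filter_upwards [hkey] with z h1
        rw [h1, zpow_natCast])
    simp only [sub_self, zero_mul, add_zero, one_mul, ne_eq, Nat.succ_ne_zero, not_false_eq_true,
      zero_pow] at this
    have h2 : A 1 ^ 2 = (((m + 1 : ℕ) : ℤ) : ℂ) ^ 2 := by
      apply mul_right_cancel₀ (pow_ne_zero 2 hg0)
      linear_combination -this
    rcases sq_eq_sq_iff_eq_or_eq_neg.1 h2 with h | h
    · exact ⟨_, h⟩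
    · exact ⟨-((m + 1 : ℕ) : ℤ), by rw [h]; push_cast; ring⟩
end
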